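/- arXiv:0905.0478 — 2 statements merged into one kernel-verified Lean document; each statement's English description precedes it below -/
import Mathlib

section
/- Let E be a row-finite graph, R a commutative ring with unit, and H a saturated hereditary subset of E⁰. Then the quotient L_R(E)/I_H is canonically isomorphic, as an R-algebra, to L_R(E \ H), where E \ H is the graph with vertex set E⁰ \ H, edge set E¹ \ r⁻¹(H), and range and source maps obtained by restriction. -/
set_option maxHeartbeats 1000000
set_option synthInstance.maxHeartbeats 400000

noncomputable section

/-- A directed graph `E = (E⁰, E¹, r, s)` with countable vertex and edge sets,
together with range and source maps. -/
structure LPAGraph : Type 1 where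
  V : Type
  E : Type
  countV : Countable V
  countE : Countable E
  src : E → V
  rng : E → V

namespace LPAGraph

/-- Generators of the Leavitt path algebra: vertices, real edges, and ghost edges. -/
inductive LGen (G : LPAGraph) : Type
  | vert : G.V → LGen G
  | edge : G.E → LGen G
  | ghost : G.E → LGen G

/-- `IsPathFrom G u es w` : the list of edges `es` is a path from `u` to `w`
(paths of length zero are vertices). -/
inductive IsPathFrom (G : LPAGraph) : G.V → List G.E → G.V → Prop
  | nil (v : G.V) : IsPathFrom G v [] v
  | cons {u w : G.V} (e : G.E) {es : List G.E} (h : G.src e = u)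
      (ht : IsPathFrom G (G.rng e) es w) : IsPathFrom G u (e :: es) w

/-- A vertex is regular if it emits at least one and only finitely many edges. -/
def Regular (G : LPAGraph) (v : G.V) : Prop :=
  {e : G.E | G.src e = v}.Finite ∧ {e : G.E | G.src e = v}.Nonempty

/-- A graph is row-finite if every vertex emits only finitely many edges. -/
def RowFinite (G : LPAGraph) : Prop := ∀ v : G.V, {e : G.E | G.src e = v}.Finite

/-- A subset `H` of vertices is hereditary if `s(e) ∈ H` implies `r(e) ∈ H`. -/
def Hereditary (G : LPAGraph) (H : Set G.V) : Prop :=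
  ∀ e : G.E, G.src e ∈ H → G.rng e ∈ H

/-- A subset `H` of vertices is saturated if every regular vertex, all of whose emitted
edges have range in `H`, belongs to `H`. -/
def Saturated (G : LPAGraph) (H : Set G.V) : Prop :=
  ∀ v : G.V, G.Regular v → (∀ e : G.E, G.src e = v → G.rng e ∈ H) → v ∈ H

/-- The saturation of a set of vertices: the smallest saturated hereditary subset
containing it. -/
def saturation (G : LPAGraph) (X : Set G.V) : Set G.V :=
  ⋂₀ {H : Set G.V | G.Hereditary H ∧ G.Saturated H ∧ X ⊆ H}

/-- `HasExit G es` : the path `es` has an exit, i.e. there is an edge `f` with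
`s(f) = s(eᵢ)` and `f ≠ eᵢ` for some `i`. -/
def HasExit (G : LPAGraph) (es : List G.E) : Prop :=
  ∃ (f : G.E) (i : Fin es.length), G.src f = G.src (es.get i) ∧ f ≠ es.get i

/-- Condition (L): every cycle has an exit. -/
def CondL (G : LPAGraph) : Prop :=
  ∀ (v : G.V) (es : List G.E), es ≠ [] → IsPathFrom G v es v → G.HasExit es

/-- A closed path based at `v`. -/
def IsClosedPathAt (G : LPAGraph) (v : G.V) (es : List G.E) : Prop :=
  es ≠ [] ∧ IsPathFrom G v es v

/-- A simple closed path based at `v` : a closed path `e₁ … eₙ` based at `v` with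
`s(eᵢ) ≠ v` for `i = 2, …, n`. -/
def IsSimpleClosedPathAt (G : LPAGraph) (v : G.V) (es : List G.E) : Prop :=
  G.IsClosedPathAt v es ∧ ∀ i : Fin es.length, i.1 ≠ 0 → G.src (es.get i) ≠ v

/-- Condition (K): every vertex is the base of no closed path or of at least two
distinct simple closed paths. -/
def CondK (G : LPAGraph) : Prop :=
  ∀ v : G.V, (¬ ∃ es : List G.E, G.IsClosedPathAt v es) ∨
    (∃ es₁ es₂ : List G.E, G.IsSimpleClosedPathAt v es₁ ∧ G.IsSimpleClosedPathAt v es₂ ∧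
      es₁ ≠ es₂)

variable (R : Type) [CommRing R] (G : LPAGraph)

open FreeAlgebra in
/-- The defining relations of the Leavitt path algebra (the relations of a
Leavitt `E`-family). -/
inductive LeavittRel : FreeAlgebra R (LGen G) → FreeAlgebra R (LGen G) → Prop
  | vert_mul_self (v : G.V) :
      LeavittRel (ι R (LGen.vert v) * ι R (LGen.vert v)) (ι R (LGen.vert v))
  | vert_mul_vert (v w : G.V) (hvw : v ≠ w) :
      LeavittRel (ι R (LGen.vert v) * ι R (LGen.vert w)) 0
  | src_mul_edge (e : G.E) :
      LeavittRel (ι R (LGen.vert (G.src e)) * ι R (LGen.edge e)) (ι R (LGen.edge e))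
  | edge_mul_rng (e : G.E) :
      LeavittRel (ι R (LGen.edge e) * ι R (LGen.vert (G.rng e))) (ι R (LGen.edge e))
  | rng_mul_ghost (e : G.E) :
      LeavittRel (ι R (LGen.vert (G.rng e)) * ι R (LGen.ghost e)) (ι R (LGen.ghost e))
  | ghost_mul_src (e : G.E) :
      LeavittRel (ι R (LGen.ghost e) * ι R (LGen.vert (G.src e))) (ι R (LGen.ghost e))
  | ghost_mul_self (e : G.E) :
      LeavittRel (ι R (LGen.ghost e) * ι R (LGen.edge e)) (ι R (LGen.vert (G.rng e)))
  | ghost_mul_edge (e f : G.E) (hef : e ≠ f) :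
      LeavittRel (ι R (LGen.ghost e) * ι R (LGen.edge f)) 0
  | ck (v : G.V) (s : Finset G.E) (hs : ∀ e : G.E, e ∈ s ↔ G.src e = v) (hne : s.Nonempty) :
      LeavittRel (ι R (LGen.vert v)) (∑ e ∈ s, ι R (LGen.edge e) * ι R (LGen.ghost e))

/-- The ambient unital algebra: the universal unital `R`-algebra on the Leavitt relations. -/
abbrev Ambient : Type := RingQuot (LeavittRel R G)

/-- The images of the generators in the ambient algebra. -/
def ugen (x : LGen G) : Ambient R G :=
  RingQuot.mkAlgHom R (LeavittRel R G) (FreeAlgebra.ι R x)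

/-- The Leavitt path algebra `L_R(E)`, realized as the non-unital subalgebra of the ambient
algebra generated by the Leavitt `E`-family (equivalently, the span of words in the
generators). -/
def LeavittSubalgebra : NonUnitalSubalgebra R (Ambient R G) :=
  NonUnitalAlgebra.adjoin R (Set.range (ugen R G))

/-- The Leavitt path algebra `L_R(E)` as a type; it is a non-unital `R`-algebra. -/
abbrev LeavittPathAlgebra : Type := ↥(LeavittSubalgebra R G)

theorem ugen_mem (x : LGen G) : ugen R G x ∈ LeavittSubalgebra R G :=
  NonUnitalAlgebra.subset_adjoin R (Set.mem_range_self x)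

/-- The vertex idempotent `v ∈ L_R(E)`. -/
def vertexElem (v : G.V) : LeavittPathAlgebra R G :=
  ⟨ugen R G (LGen.vert v), ugen_mem R G _⟩

/-- The real edge `e ∈ L_R(E)`. -/
def edgeElem (e : G.E) : LeavittPathAlgebra R G :=
  ⟨ugen R G (LGen.edge e), ugen_mem R G _⟩

/-- The ghost edge `e* ∈ L_R(E)`. -/
def ghostElem (e : G.E) : LeavittPathAlgebra R G :=
  ⟨ugen R G (LGen.ghost e), ugen_mem R G _⟩

/-- The element `α = e₁ ⋯ eₙ` of the ambient algebra corresponding to a path; a path of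
length zero starting at `u` is the vertex `u`. -/
def uPath (u : G.V) (es : List G.E) : Ambient R G :=
  ugen R G (LGen.vert u) * (es.map fun e => ugen R G (LGen.edge e)).prod

/-- The element `α* = eₙ* ⋯ e₁*` of the ambient algebra corresponding to a ghost path. -/
def uGhostPath (u : G.V) (es : List G.E) : Ambient R G :=
  ((es.map fun e => ugen R G (LGen.ghost e)).reverse).prod * ugen R G (LGen.vert u)

private theorem list_prod_mem_aux (f : G.E → Ambient R G)
    (hf : ∀ e, f e ∈ LeavittSubalgebra R G) :
    ∀ es : List G.E, es ≠ [] → (es.map f).prod ∈ LeavittSubalgebra R G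
  | [], h => absurd rfl h
  | [e], _ => by simpa using hf e
  | e :: e' :: t, _ => by
      rw [List.map_cons, List.prod_cons]
      exact mul_mem (hf e) (list_prod_mem_aux f hf (e' :: t) (by simp))

theorem uPath_mem (u : G.V) (es : List G.E) : uPath R G u es ∈ LeavittSubalgebra R G := by
  cases es with
  | nil => simpa [uPath] using ugen_mem R G (LGen.vert u)
  | cons e t =>
      exact mul_mem (ugen_mem R G (LGen.vert u))
        (list_prod_mem_aux R G _ (fun e => ugen_mem R G (LGen.edge e)) (e :: t) (by simp))

theorem uGhostPath_mem (u : G.V) (es : List G.E) :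
    uGhostPath R G u es ∈ LeavittSubalgebra R G := by
  cases es with
  | nil => simpa [uGhostPath] using ugen_mem R G (LGen.vert u)
  | cons e t =>
      rw [uGhostPath, ← List.map_reverse]
      exact mul_mem
        (list_prod_mem_aux R G _ (fun e => ugen_mem R G (LGen.ghost e)) ((e :: t).reverse)
          (by simp))
        (ugen_mem R G (LGen.vert u))

/-- The element of `L_R(E)` corresponding to the path `α` with source `u` and edge list
`es` (for `es = []` this is the vertex `u`). -/
def pathElem (u : G.V) (es : List G.E) : LeavittPathAlgebra R G :=
  ⟨uPath R G u es, uPath_mem R G u es⟩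

/-- The element of `L_R(E)` corresponding to the ghost path `α*` where `α` has source `u`
and edge list `es` (for `es = []` this is the vertex `u`). -/
def ghostPathElem (u : G.V) (es : List G.E) : LeavittPathAlgebra R G :=
  ⟨uGhostPath R G u es, uGhostPath_mem R G u es⟩

/-- The set of monomials `α β*` where `α, β` are paths with `r(α) = r(β)`. -/
def monomialSet : Set (LeavittPathAlgebra R G) :=
  {x | ∃ (u : G.V) (es : List G.E) (u' : G.V) (es' : List G.E) (w : G.V),
    IsPathFrom G u es w ∧ IsPathFrom G u' es' w ∧
    x = pathElem R G u es * ghostPathElem R G u' es'}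

/-- The degree-`k` homogeneous component `L_R(E)ₖ` of the canonical `ℤ`-grading:
the `R`-span of the monomials `α β*` with `|α| - |β| = k`. -/
def component (k : ℤ) : Submodule R (LeavittPathAlgebra R G) :=
  Submodule.span R
    {x | ∃ (u : G.V) (es : List G.E) (u' : G.V) (es' : List G.E) (w : G.V),
      IsPathFrom G u es w ∧ IsPathFrom G u' es' w ∧
      (es.length : ℤ) - (es'.length : ℤ) = k ∧
      x = pathElem R G u es * ghostPathElem R G u' es'}

/-- An ideal `I` of `L_R(E)` is basic if `r • v ∈ I` with `r ∈ R \ {0}` and `v` a vertex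
implies `v ∈ I`. -/
def IsBasicIdeal (I : TwoSidedIdeal (LeavittPathAlgebra R G)) : Prop :=
  ∀ (r : R) (v : G.V), r ≠ 0 → r • vertexElem R G v ∈ I → vertexElem R G v ∈ I

/-- An ideal `I` of the `ℤ`-graded ring `L_R(E)` is graded if `I = ⊕ₖ (I ∩ L_R(E)ₖ)`,
i.e. every element of `I` is a finite sum of homogeneous elements of `I`. -/
def IsGradedIdeal (I : TwoSidedIdeal (LeavittPathAlgebra R G)) : Prop :=
  ∀ x ∈ I, ∃ (n : ℕ) (c : Fin n → LeavittPathAlgebra R G),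
    (∀ i, c i ∈ I ∧ ∃ k : ℤ, c i ∈ component R G k) ∧ x = ∑ i, c i

/-- The two-sided ideal of `L_R(E)` generated by the vertices in a set `H` of vertices. -/
def idealOfSet (H : Set G.V) : TwoSidedIdeal (LeavittPathAlgebra R G) :=
  TwoSidedIdeal.span {x | ∃ v ∈ H, x = vertexElem R G v}

/-- `x ∈ L_R(E)` is a polynomial in only real edges if it is an `R`-linear combination of
(real) paths. -/
def IsRealPoly (x : LeavittPathAlgebra R G) : Prop :=
  x ∈ Submodule.span R
    {y | ∃ (u : G.V) (es : List G.E) (w : G.V), IsPathFrom G u es w ∧ y = pathElem R G u es}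

end LPAGraph
namespace LPAGraph

/-- The graph `E ∖ H` determined by a hereditary subset `H ⊆ E⁰`: its vertices are
`E⁰ ∖ H`, its edges are `E¹ ∖ r⁻¹(H)`, and the range and source maps are obtained by
restriction. -/
def minusGraph (G : LPAGraph) (H : Set G.V) (hH : G.Hereditary H) : LPAGraph where
  V := {v : G.V // v ∉ H}
  E := {e : G.E // G.rng e ∉ H}
  countV := by haveI := G.countV; exact inferInstance
  countE := by haveI := G.countE; exact inferInstance
  src := fun e => ⟨G.src e.1, fun hs => e.2 (hH e.1 hs)⟩
  rng := fun e => ⟨G.rng e.1, e.2⟩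

end LPAGraph

namespace LPAGraph

/-- A Leavitt family in a unital algebra. -/
structure IsFamily (G : LPAGraph) {A : Type} [Ring A] (f : LGen G → A) : Prop where
  vv : ∀ v, f (.vert v) * f (.vert v) = f (.vert v)
  vw : ∀ v w, v ≠ w → f (.vert v) * f (.vert w) = 0
  se : ∀ e, f (.vert (G.src e)) * f (.edge e) = f (.edge e)
  er : ∀ e, f (.edge e) * f (.vert (G.rng e)) = f (.edge e)
  rg : ∀ e, f (.vert (G.rng e)) * f (.ghost e) = f (.ghost e)
  gs : ∀ e, f (.ghost e) * f (.vert (G.src e)) = f (.ghost e)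
  ge : ∀ e, f (.ghost e) * f (.edge e) = f (.vert (G.rng e))
  gf : ∀ e e', e ≠ e' → f (.ghost e) * f (.edge e') = 0
  ck : ∀ (v : G.V) (s : Finset G.E), (∀ e : G.E, e ∈ s ↔ G.src e = v) → s.Nonempty →
    f (.vert v) = ∑ e ∈ s, f (.edge e) * f (.ghost e)

theorem ugen_isFamily (R : Type) [CommRing R] (G : LPAGraph) : IsFamily G (ugen R G) where
  vv v := by
    simpa [ugen] using RingQuot.mkAlgHom_rel R (LeavittRel.vert_mul_self (R := R) (G := G) v)
  vw v w h := by
    simpa [ugen] using RingQuot.mkAlgHom_rel R (LeavittRel.vert_mul_vert (R := R) (G := G) v w h)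
  se e := by
    simpa [ugen] using RingQuot.mkAlgHom_rel R (LeavittRel.src_mul_edge (R := R) (G := G) e)
  er e := by
    simpa [ugen] using RingQuot.mkAlgHom_rel R (LeavittRel.edge_mul_rng (R := R) (G := G) e)
  rg e := by
    simpa [ugen] using RingQuot.mkAlgHom_rel R (LeavittRel.rng_mul_ghost (R := R) (G := G) e)
  gs e := by
    simpa [ugen] using RingQuot.mkAlgHom_rel R (LeavittRel.ghost_mul_src (R := R) (G := G) e)
  ge e := by
    simpa [ugen] using RingQuot.mkAlgHom_rel R (LeavittRel.ghost_mul_self (R := R) (G := G) e)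
  gf e e' h := by
    simpa [ugen] using RingQuot.mkAlgHom_rel R (LeavittRel.ghost_mul_edge (R := R) (G := G) e e' h)
  ck v s hs hne := by
    simpa [ugen] using RingQuot.mkAlgHom_rel R (LeavittRel.ck (R := R) (G := G) v s hs hne)

theorem IsFamily.map {G : LPAGraph} {A B : Type} [Ring A] [Ring B] {f : LGen G → A}
    (h : IsFamily G f) (g : A →+* B) : IsFamily G (fun x => g (f x)) where
  vv v := by rw [← map_mul, h.vv]
  vw v w hw := by rw [← map_mul, h.vw v w hw, map_zero]
  se e := by rw [← map_mul, h.se]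
  er e := by rw [← map_mul, h.er]
  rg e := by rw [← map_mul, h.rg]
  gs e := by rw [← map_mul, h.gs]
  ge e := by rw [← map_mul, h.ge]
  gf v w hw := by rw [← map_mul, h.gf v w hw, map_zero]
  ck v s hs hne := by simp only [← map_mul, ← map_sum]; rw [h.ck v s hs hne]

/-- Universal property of the ambient algebra. -/
theorem exists_lift (R : Type) [CommRing R] (G : LPAGraph) {A : Type} [Ring A] [Algebra R A]
    {f : LGen G → A} (h : IsFamily G f) :
    ∃ φ : Ambient R G →ₐ[R] A, ∀ x, φ (ugen R G x) = f x := by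
  refine ⟨RingQuot.liftAlgHom R ⟨FreeAlgebra.lift R f, ?_⟩, ?_⟩
  · intro x y hxy
    cases hxy with
    | vert_mul_self v => simpa using h.vv v
    | vert_mul_vert v w hvw => simpa using h.vw v w hvw
    | src_mul_edge e => simpa using h.se e
    | edge_mul_rng e => simpa using h.er e
    | rng_mul_ghost e => simpa using h.rg e
    | ghost_mul_src e => simpa using h.gs e
    | ghost_mul_self e => simpa using h.ge e
    | ghost_mul_edge e e' hne => simpa using h.gf e e' hne
    | ck v s hs hne => simpa using h.ck v s hs hne
  · intro x
    simp [ugen]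

theorem ambient_induction (R : Type) [CommRing R] (G : LPAGraph) {P : Ambient R G → Prop}
    (hs : ∀ r : R, P (algebraMap R _ r)) (hg : ∀ x, P (ugen R G x))
    (hm : ∀ a b, P a → P b → P (a * b)) (ha : ∀ a b, P a → P b → P (a + b)) (a) : P a := by
  obtain ⟨a, rfl⟩ := RingQuot.mkAlgHom_surjective R (LeavittRel R G) a
  induction a using FreeAlgebra.induction with
  | grade0 r => simpa using hs r
  | grade1 x => exact hg x
  | mul a b h1 h2 => rw [map_mul]; exact hm _ _ h1 h2
  | add a b h1 h2 => rw [map_add]; exact ha _ _ h1 h2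

theorem mul_mem_left' (R : Type) [CommRing R] (G : LPAGraph) (a : Ambient R G) :
    ∀ x ∈ LeavittSubalgebra R G, a * x ∈ LeavittSubalgebra R G := by
  induction a using ambient_induction with
  | hs r => intro x hx; rw [← Algebra.smul_def]; exact SMulMemClass.smul_mem r hx
  | hg y => intro x hx; exact mul_mem (ugen_mem R G y) hx
  | hm a b h1 h2 => intro x hx; rw [mul_assoc]; exact h1 _ (h2 _ hx)
  | ha a b h1 h2 => intro x hx; rw [add_mul]; exact add_mem (h1 _ hx) (h2 _ hx)

theorem mul_mem_right' (R : Type) [CommRing R] (G : LPAGraph) (a : Ambient R G) :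
    ∀ x ∈ LeavittSubalgebra R G, x * a ∈ LeavittSubalgebra R G := by
  induction a using ambient_induction with
  | hs r =>
    intro x hx; rw [← Algebra.commutes, ← Algebra.smul_def]; exact SMulMemClass.smul_mem r hx
  | hg y => intro x hx; exact mul_mem hx (ugen_mem R G y)
  | hm a b h1 h2 => intro x hx; rw [← mul_assoc]; exact h2 _ (h1 _ hx)
  | ha a b h1 h2 => intro x hx; rw [mul_add]; exact add_mem (h1 _ hx) (h2 _ hx)

/-- The ideal of the ambient algebra generated by the vertices in `H`. -/
def ambIdeal (R : Type) [CommRing R] (G : LPAGraph) (H : Set G.V) :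
    TwoSidedIdeal (Ambient R G) :=
  TwoSidedIdeal.span {x | ∃ v ∈ H, x = ugen R G (.vert v)}

theorem ambIdeal_mem (R : Type) [CommRing R] (G : LPAGraph) (H : Set G.V) (y : Ambient R G)
    (hy : y ∈ ambIdeal R G H) :
    ∃ h : y ∈ LeavittSubalgebra R G, (⟨y, h⟩ : LeavittPathAlgebra R G) ∈ idealOfSet R G H := by
  rw [ambIdeal, TwoSidedIdeal.mem_span_iff_mem_addSubgroup_closure] at hy
  induction hy using AddSubgroup.closure_induction with
  | mem x hx =>
    obtain ⟨_, ⟨a, -, _, ⟨v, hv, rfl⟩, rfl⟩, b, -, rfl⟩ := hx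
    have hvv := (ugen_isFamily R G).vv v
    have hl := mul_mem_left' R G a _ (ugen_mem R G (.vert v))
    have hr := mul_mem_right' R G b _ (ugen_mem R G (.vert v))
    have key : a * ugen R G (.vert v) * b
        = (a * ugen R G (.vert v)) * ugen R G (.vert v) * (ugen R G (.vert v) * b) := by
      rw [mul_assoc a (ugen R G (.vert v)) (ugen R G (.vert v)), hvv, ← mul_assoc,
        mul_assoc a (ugen R G (.vert v)) (ugen R G (.vert v)), hvv]
    have hI : (⟨_, hl⟩ : LeavittPathAlgebra R G) * vertexElem R G v * ⟨_, hr⟩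
        ∈ idealOfSet R G H :=
      TwoSidedIdeal.mul_mem_right _ _ _ (TwoSidedIdeal.mul_mem_left _ _ _
        (TwoSidedIdeal.subset_span ⟨v, hv, rfl⟩))
    refine ⟨mul_mem_right' R G b _ hl, ?_⟩
    convert hI using 1
    exact Subtype.ext key
  | zero => exact ⟨zero_mem _, TwoSidedIdeal.zero_mem _⟩
  | add x y _ _ h1 h2 =>
    obtain ⟨h1, h1'⟩ := h1
    obtain ⟨h2, h2'⟩ := h2
    exact ⟨add_mem h1 h2, TwoSidedIdeal.add_mem _ h1' h2'⟩
  | neg x _ h1 =>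
    obtain ⟨h1, h1'⟩ := h1
    exact ⟨neg_mem h1, TwoSidedIdeal.neg_mem _ h1'⟩

open Classical in
/-- The images of the generators under the canonical map. -/
def fgen (R : Type) [CommRing R] (G : LPAGraph) (H : Set G.V) (hH : G.Hereditary H) :
    LGen G → Ambient R (G.minusGraph H hH)
  | .vert v => if h : v ∉ H then ugen R (G.minusGraph H hH) (.vert ⟨v, h⟩) else 0
  | .edge e => if h : G.rng e ∉ H then ugen R (G.minusGraph H hH) (.edge ⟨e, h⟩) else 0
  | .ghost e => if h : G.rng e ∉ H then ugen R (G.minusGraph H hH) (.ghost ⟨e, h⟩) else 0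

theorem fgen_isFamily (R : Type) [CommRing R] (G : LPAGraph) (H : Set G.V)
    (hH : G.Hereditary H) (hrf : G.RowFinite) (hS : G.Saturated H) :
    IsFamily G (fgen R G H hH) where
  vv v := by
    by_cases h : v ∈ H
    · simp [fgen, h]
    · simp only [fgen, h, not_false_eq_true, dite_true]
      exact (ugen_isFamily R (G.minusGraph H hH)).vv ⟨v, h⟩
  vw v w hvw := by
    by_cases h : v ∈ H
    · simp [fgen, h]
    by_cases h' : w ∈ H
    · simp [fgen, h']
    · simp only [fgen, h, h', not_false_eq_true, dite_true]
      exact (ugen_isFamily R (G.minusGraph H hH)).vw ⟨v, h⟩ ⟨w, h'⟩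
        (fun hh => hvw (congrArg Subtype.val hh))
  se e := by
    by_cases h : G.rng e ∈ H
    · simp [fgen, h]
    · have h' : G.src e ∉ H := fun hs => h (hH e hs)
      simp only [fgen, h, h', not_false_eq_true, dite_true]
      exact (ugen_isFamily R (G.minusGraph H hH)).se ⟨e, h⟩
  er e := by
    by_cases h : G.rng e ∈ H
    · simp [fgen, h]
    · simp only [fgen, h, not_false_eq_true, dite_true]
      exact (ugen_isFamily R (G.minusGraph H hH)).er ⟨e, h⟩
  rg e := by
    by_cases h : G.rng e ∈ H
    · simp [fgen, h]
    · simp only [fgen, h, not_false_eq_true, dite_true]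
      exact (ugen_isFamily R (G.minusGraph H hH)).rg ⟨e, h⟩
  gs e := by
    by_cases h : G.rng e ∈ H
    · simp [fgen, h]
    · have h' : G.src e ∉ H := fun hs => h (hH e hs)
      simp only [fgen, h, h', not_false_eq_true, dite_true]
      exact (ugen_isFamily R (G.minusGraph H hH)).gs ⟨e, h⟩
  ge e := by
    by_cases h : G.rng e ∈ H
    · simp [fgen, h]
    · simp only [fgen, h, not_false_eq_true, dite_true]
      exact (ugen_isFamily R (G.minusGraph H hH)).ge ⟨e, h⟩
  gf e f hef := by
    by_cases h : G.rng e ∈ H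
    · simp [fgen, h]
    by_cases h' : G.rng f ∈ H
    · simp [fgen, h']
    · simp only [fgen, h, h', not_false_eq_true, dite_true]
      exact (ugen_isFamily R (G.minusGraph H hH)).gf ⟨e, h⟩ ⟨f, h'⟩
        (fun hh => hef (congrArg Subtype.val hh))
  ck v s hs hne := by
    classical
    by_cases h : v ∈ H
    · have h1 : fgen R G H hH (.vert v) = 0 := by simp [fgen, h]
      rw [h1]
      symm
      apply Finset.sum_eq_zero
      intro e he
      have : G.rng e ∈ H := hH e (by rw [(hs e).1 he]; exact h)
      simp [fgen, this]
    · have hex : ∃ e, G.src e = v ∧ G.rng e ∉ H := by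
        by_contra hcon
        push Not at hcon
        obtain ⟨e, he⟩ := hne
        exact h (hS v ⟨hrf v, e, (hs e).1 he⟩ hcon)
      let t : Finset (G.minusGraph H hH).E := s.subtype (fun e => G.rng e ∉ H)
      have ht : ∀ e, e ∈ t ↔ (G.minusGraph H hH).src e = ⟨v, h⟩ := by
        intro e
        refine (Finset.mem_subtype (p := fun e => G.rng e ∉ H) (s := s) (a := e)).trans ?_
        rw [hs]
        exact (Subtype.ext_iff (a1 := (G.minusGraph H hH).src e) (a2 := ⟨v, h⟩)).symm
      have hck := (ugen_isFamily R (G.minusGraph H hH)).ck ⟨v, h⟩ t ht (by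
        obtain ⟨e, he, hr⟩ := hex
        exact ⟨⟨e, hr⟩, (ht _).2 (Subtype.ext he)⟩)
      have h1 : fgen R G H hH (.vert v) = ugen R (G.minusGraph H hH) (.vert ⟨v, h⟩) := by
        simp [fgen, h]
      rw [h1, hck, ← Finset.sum_filter_of_ne (s := s) (p := fun e => G.rng e ∉ H),
        ← Finset.sum_subtype_eq_sum_filter]
      · apply Finset.sum_congr rfl
        intro e _
        have := e.2
        simp only [fgen, this, not_false_eq_true, dite_true]
        rfl
      · intro e _ hne hr
        exact hne (by simp [fgen, hr])

/-- The quotient map modulo the ambient ideal. -/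
def qmap (R : Type) [CommRing R] (G : LPAGraph) (H : Set G.V) :
    Ambient R G →ₐ[R] (ambIdeal R G H).ringCon.Quotient :=
  { (ambIdeal R G H).ringCon.mk' with commutes' := fun _ => rfl }

theorem qmap_eq_zero (R : Type) [CommRing R] (G : LPAGraph) (H : Set G.V) (x : Ambient R G) :
    qmap R G H x = 0 ↔ x ∈ ambIdeal R G H := by
  conv_rhs => rw [← TwoSidedIdeal.ker_ringCon_mk' (ambIdeal R G H), TwoSidedIdeal.mem_ker]
  rfl

theorem qmap_vert (R : Type) [CommRing R] (G : LPAGraph) (H : Set G.V) (v : G.V) (hv : v ∈ H) :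
    qmap R G H (ugen R G (.vert v)) = 0 :=
  (qmap_eq_zero _ _ _ _).2 (TwoSidedIdeal.subset_span ⟨v, hv, rfl⟩)

theorem qmap_edge (R : Type) [CommRing R] (G : LPAGraph) (H : Set G.V) (e : G.E)
    (he : G.rng e ∈ H) : qmap R G H (ugen R G (.edge e)) = 0 := by
  rw [← (ugen_isFamily R G).er, map_mul, qmap_vert R G H _ he, mul_zero]

theorem qmap_ghost (R : Type) [CommRing R] (G : LPAGraph) (H : Set G.V) (e : G.E)
    (he : G.rng e ∈ H) : qmap R G H (ugen R G (.ghost e)) = 0 := by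
  rw [← (ugen_isFamily R G).rg, map_mul, qmap_vert R G H _ he, zero_mul]

/-- Inclusion of generators. -/
def incl (G : LPAGraph) (H : Set G.V) (hH : G.Hereditary H) :
    LGen (G.minusGraph H hH) → LGen G
  | .vert v => .vert v.1
  | .edge e => .edge e.1
  | .ghost e => .ghost e.1

theorem q_isFamily (R : Type) [CommRing R] (G : LPAGraph) (H : Set G.V)
    (hH : G.Hereditary H) (hrf : G.RowFinite) :
    IsFamily (G.minusGraph H hH) (fun x => qmap R G H (ugen R G (incl G H hH x))) := by
  have F : IsFamily G (fun x => qmap R G H (ugen R G x)) :=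
    (ugen_isFamily R G).map (qmap R G H).toRingHom
  exact {
    vv := fun v => F.vv v.1
    vw := fun v w h => F.vw v.1 w.1 (fun hh => h (Subtype.ext hh))
    se := fun e => F.se e.1
    er := fun e => F.er e.1
    rg := fun e => F.rg e.1
    gs := fun e => F.gs e.1
    ge := fun e => F.ge e.1
    gf := fun e f h => F.gf e.1 f.1 (fun hh => h (Subtype.ext hh))
    ck := by
      classical
      intro v t ht hne
      have hfin := hrf v.1
      have hs : ∀ e, e ∈ hfin.toFinset ↔ G.src e = v.1 := by intro e; simp
      have hts : t = hfin.toFinset.subtype (fun e => G.rng e ∉ H) := by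
        ext e
        refine (ht e).trans (Iff.trans ?_ (Finset.mem_subtype (p := fun e => G.rng e ∉ H)
          (s := hfin.toFinset) (a := e)).symm)
        rw [hs]
        exact Subtype.ext_iff
      have hck := F.ck v.1 hfin.toFinset hs (by
        obtain ⟨e, he⟩ := hne
        exact ⟨e.1, (hs _).2 (congrArg Subtype.val ((ht e).1 he))⟩)
      refine hck.trans ?_
      rw [hts, ← Finset.sum_filter_of_ne (s := hfin.toFinset) (p := fun e => G.rng e ∉ H),
        ← Finset.sum_subtype_eq_sum_filter]
      · rfl
      · intro e _ hne hr
        exact hne (by rw [qmap_edge R G H e hr, zero_mul]) }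

end LPAGraph

open LPAGraph in
/-- **Theorem.**  Let `E` be a row-finite graph, `R` a commutative ring with unit, and `H`
a saturated hereditary subset of `E⁰`.  Then `L_R(E)/I_H` is canonically isomorphic to
`L_R(E ∖ H)` as an `R`-algebra: the canonical `R`-algebra homomorphism
`π : L_R(E) → L_R(E ∖ H)` (sending a vertex `v` to `v` if `v ∉ H` and to `0` otherwise, and
an edge `e` to `e` if `r(e) ∉ H` and to `0` otherwise, and similarly for ghost edges) is
surjective with kernel exactly `I_H`. -/
theorem stmt15 (R : Type) [CommRing R] (G : LPAGraph) (hrf : G.RowFinite)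
    (H : Set G.V) (hHer : G.Hereditary H) (hSat : G.Saturated H) :
    ∃ π : LeavittPathAlgebra R G →ₙₐ[R] LeavittPathAlgebra R (G.minusGraph H hHer),
      (∀ (v : G.V), v ∈ H → π (vertexElem R G v) = 0) ∧
      (∀ (v : G.V) (hv : v ∉ H),
        π (vertexElem R G v) = vertexElem R (G.minusGraph H hHer) ⟨v, hv⟩) ∧
      (∀ (e : G.E), G.rng e ∈ H → π (edgeElem R G e) = 0) ∧
      (∀ (e : G.E) (he : G.rng e ∉ H),
        π (edgeElem R G e) = edgeElem R (G.minusGraph H hHer) ⟨e, he⟩) ∧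
      (∀ (e : G.E), G.rng e ∈ H → π (ghostElem R G e) = 0) ∧
      (∀ (e : G.E) (he : G.rng e ∉ H),
        π (ghostElem R G e) = ghostElem R (G.minusGraph H hHer) ⟨e, he⟩) ∧
      Function.Surjective π ∧
      (∀ x : LeavittPathAlgebra R G, π x = 0 ↔ x ∈ idealOfSet R G H) := by
  classical
  obtain ⟨φ, hφ⟩ := exists_lift R G (fgen_isFamily R G H hHer hrf hSat)
  obtain ⟨ψ, hψ⟩ := exists_lift R (G.minusGraph H hHer) (q_isFamily R G H hHer hrf)
  have hcomp : ∀ x, ψ (φ x) = qmap R G H x := by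
    intro x
    induction x using ambient_induction with
    | hs r => simp only [AlgHom.commutes]
    | hm a b h1 h2 => simp only [map_mul, h1, h2]
    | ha a b h1 h2 => simp only [map_add, h1, h2]
    | hg y =>
      rw [hφ]
      cases y with
      | vert v =>
        by_cases h : v ∈ H
        · simp [fgen, h, qmap_vert R G H v h]
        · simp [fgen, h, hψ, incl]
      | edge e =>
        by_cases h : G.rng e ∈ H
        · simp [fgen, h, qmap_edge R G H e h]
        · simp [fgen, h, hψ, incl]
      | ghost e =>
        by_cases h : G.rng e ∈ H
        · simp [fgen, h, qmap_ghost R G H e h]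
        · simp [fgen, h, hψ, incl]
  have hmem : ∀ x ∈ LeavittSubalgebra R G,
      φ x ∈ LeavittSubalgebra R (G.minusGraph H hHer) := by
    intro x hx
    induction hx using NonUnitalAlgebra.adjoin_induction with
    | mem x hx =>
      obtain ⟨y, rfl⟩ := hx
      rw [hφ]
      cases y <;> simp only [fgen] <;> split_ifs <;>
        first | exact ugen_mem _ _ _ | exact zero_mem _
    | add x y _ _ h1 h2 => rw [map_add]; exact add_mem h1 h2
    | zero => rw [map_zero]; exact zero_mem _
    | mul x y _ _ h1 h2 => rw [map_mul]; exact mul_mem h1 h2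
    | smul r x _ h => rw [map_smul]; exact SMulMemClass.smul_mem r h
  let π : LeavittPathAlgebra R G →ₙₐ[R] LeavittPathAlgebra R (G.minusGraph H hHer) :=
    { toFun := fun x => ⟨φ x.1, hmem x.1 x.2⟩
      map_smul' := fun r x => Subtype.ext (map_smul φ r x.1)
      map_zero' := Subtype.ext (map_zero φ)
      map_add' := fun x y => Subtype.ext (map_add φ x.1 y.1)
      map_mul' := fun x y => Subtype.ext (map_mul φ x.1 y.1) }
  have hπ : ∀ x, (π x).1 = φ x.1 := fun _ => rfl
  have v0 : ∀ (v : G.V), v ∈ H → π (vertexElem R G v) = 0 := by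
    intro v hv
    apply Subtype.ext
    rw [hπ]
    simp [vertexElem, hφ, fgen, hv]
  have v1 : ∀ (v : G.V) (hv : v ∉ H),
      π (vertexElem R G v) = vertexElem R (G.minusGraph H hHer) ⟨v, hv⟩ := by
    intro v hv
    apply Subtype.ext
    rw [hπ]
    simp [vertexElem, hφ, fgen, hv]
  have e0 : ∀ (e : G.E), G.rng e ∈ H → π (edgeElem R G e) = 0 := by
    intro v hv
    apply Subtype.ext
    rw [hπ]
    simp [edgeElem, hφ, fgen, hv]
  have e1 : ∀ (e : G.E) (he : G.rng e ∉ H),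
      π (edgeElem R G e) = edgeElem R (G.minusGraph H hHer) ⟨e, he⟩ := by
    intro v hv
    apply Subtype.ext
    rw [hπ]
    simp [edgeElem, hφ, fgen, hv]
  have g0 : ∀ (e : G.E), G.rng e ∈ H → π (ghostElem R G e) = 0 := by
    intro v hv
    apply Subtype.ext
    rw [hπ]
    simp [ghostElem, hφ, fgen, hv]
  have g1 : ∀ (e : G.E) (he : G.rng e ∉ H),
      π (ghostElem R G e) = ghostElem R (G.minusGraph H hHer) ⟨e, he⟩ := by
    intro v hv
    apply Subtype.ext
    rw [hπ]
    simp [ghostElem, hφ, fgen, hv]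
  refine ⟨π, v0, v1, e0, e1, g0, g1, ?_, ?_⟩
  · rintro ⟨y, hy⟩
    induction hy using NonUnitalAlgebra.adjoin_induction with
    | mem x hx =>
      obtain ⟨y, rfl⟩ := hx
      cases y with
      | vert v => exact ⟨_, v1 v.1 v.2⟩
      | edge e => exact ⟨_, e1 e.1 e.2⟩
      | ghost e => exact ⟨_, g1 e.1 e.2⟩
    | add x y _ _ h1 h2 =>
      obtain ⟨a, ha⟩ := h1
      obtain ⟨b, hb⟩ := h2
      exact ⟨a + b, by rw [map_add, ha, hb]; rfl⟩
    | zero => exact ⟨0, by rw [map_zero]; rfl⟩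
    | mul x y _ _ h1 h2 =>
      obtain ⟨a, ha⟩ := h1
      obtain ⟨b, hb⟩ := h2
      exact ⟨a * b, by rw [map_mul, ha, hb]; rfl⟩
    | smul r x _ h =>
      obtain ⟨a, ha⟩ := h
      exact ⟨r • a, by rw [map_smul, ha]; rfl⟩
  · intro x
    constructor
    · intro hx
      have h1 : φ x.1 = 0 := by rw [← hπ, hx]; rfl
      have h2 : qmap R G H x.1 = 0 := by rw [← hcomp, h1, map_zero]
      obtain ⟨_, h3⟩ := ambIdeal_mem R G H x.1 ((qmap_eq_zero R G H x.1).1 h2)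
      exact h3
    · intro hx
      rw [idealOfSet] at hx
      induction hx using TwoSidedIdeal.span_induction with
      | mem x hx => obtain ⟨v, hv, rfl⟩ := hx; exact v0 v hv
      | zero => exact map_zero π
      | add x y _ _ h1 h2 => rw [map_add, h1, h2, add_zero]
      | neg x _ h1 =>
        have h2 : φ x.1 = 0 := by rw [← hπ, h1]; rfl
        refine Subtype.ext ((map_neg φ x.1).trans ?_)
        rw [h2, neg_zero]
        rfl
      | left_absorb a x _ h1 => rw [map_mul, h1, mul_zero]
      | right_absorb b x _ h1 => rw [map_mul, h1, zero_mul]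
end
end

section
/- Let R be a commutative ring with unit, let n ≥ 1, and let E be the graph consisting of a single simple closed path of length n: E⁰ = {v₁, …, vₙ}, E¹ = {e₁, …, eₙ}, s(eᵢ) = vᵢ for 1 ≤ i ≤ n, r(eᵢ) = vᵢ₊₁ for 1 ≤ i < n, and r(eₙ) = v₁. Then L_R(E) ≅ Mₙ(R[x, x⁻¹]), the ring of n×n matrices over the Laurent polynomial ring over R. -/
set_option maxHeartbeats 1000000
set_option synthInstance.maxHeartbeats 400000

noncomputable section

namespace LPAGraph

/-- The graph consisting of a single simple closed path of length `n`: vertices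
`v₁, …, vₙ` (indexed by `Fin n`), edges `e₁, …, eₙ` with `s(eᵢ) = vᵢ`, `r(eᵢ) = vᵢ₊₁`
for `i < n`, and `r(eₙ) = v₁`. -/
def cycleGraph (n : ℕ) (hn : 0 < n) : LPAGraph where
  V := Fin n
  E := Fin n
  countV := inferInstance
  countE := inferInstance
  src := fun i => i
  rng := fun i => ⟨(i.1 + 1) % n, Nat.mod_lt _ hn⟩

end LPAGraph

namespace LPAGraph

/-- A Leavitt family for a finite permutation-like graph gives a unit `U` of the ambient
ring with `v i * U = e i`. -/
theorem exists_cycle_unit {A : Type} [Ring A] {ι : Type} [Fintype ι] [DecidableEq ι]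
    (nx : ι → ι) (hnx : Function.Injective nx) (v e g : ι → A)
    (hvv : ∀ i, v i * v i = v i) (hvne : ∀ i j, i ≠ j → v i * v j = 0)
    (hve : ∀ i, v i * e i = e i) (hev : ∀ i, e i * v (nx i) = e i)
    (hvg : ∀ i, v (nx i) * g i = g i) (hgv : ∀ i, g i * v i = g i)
    (hge : ∀ i, g i * e i = v (nx i))
    (hck : ∀ i, v i = e i * g i) :
    ∃ U : Aˣ, ∀ i, v i * (U : A) = e i ∧ (U : A) * v (nx i) = e i ∧
      v (nx i) * ((U⁻¹ : Aˣ) : A) = g i := by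
  have hvu : ∀ i, v i * ∑ j, e j = e i := by
    intro i
    rw [Finset.mul_sum, Finset.sum_eq_single i]
    · exact hve i
    · intro j _ hj
      rw [← hve j, ← mul_assoc, hvne i j hj.symm, zero_mul]
    · simp
  have huv : ∀ i, (∑ j, e j) * v (nx i) = e i := by
    intro i
    rw [Finset.sum_mul, Finset.sum_eq_single i]
    · exact hev i
    · intro j _ hj
      rw [← hev j, mul_assoc, hvne _ _ (fun h => hj (hnx h)), mul_zero]
    · simp
  have hvus : ∀ i, v (nx i) * ∑ j, g j = g i := by
    intro i
    rw [Finset.mul_sum, Finset.sum_eq_single i]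
    · exact hvg i
    · intro j _ hj
      rw [← hvg j, ← mul_assoc, hvne _ _ (fun h => hj (hnx h).symm), zero_mul]
    · simp
  have husv : ∀ i, (∑ j, g j) * v i = g i := by
    intro i
    rw [Finset.sum_mul, Finset.sum_eq_single i]
    · exact hgv i
    · intro j _ hj
      rw [← hgv j, mul_assoc, hvne _ _ hj, mul_zero]
    · simp
  have hbij : Function.Bijective nx := Finite.injective_iff_bijective.mp hnx
  have hp : ∑ i, v (nx i) = ∑ i, v i := hbij.sum_comp v
  have hvp : ∀ i, v i * ∑ j, v j = v i := by
    intro i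
    rw [Finset.mul_sum, Finset.sum_eq_single i]
    · exact hvv i
    · intro j _ hj
      exact hvne i j hj.symm
    · simp
  have hpv : ∀ i, (∑ j, v j) * v i = v i := by
    intro i
    rw [Finset.sum_mul, Finset.sum_eq_single i]
    · exact hvv i
    · intro j _ hj
      exact hvne j i hj
    · simp
  have hpp : (∑ j, v j) * ∑ j, v j = ∑ j, v j := by
    rw [Finset.sum_mul]
    exact Finset.sum_congr rfl fun i _ => hvp i
  have hpu : (∑ j, v j) * ∑ j, e j = ∑ j, e j := by
    rw [Finset.sum_mul]
    exact Finset.sum_congr rfl fun i _ => hvu i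
  have hpus : (∑ j, v j) * ∑ j, g j = ∑ j, g j := by
    rw [← hp, Finset.sum_mul]
    exact Finset.sum_congr rfl fun i _ => hvus i
  have hup : (∑ j, e j) * ∑ j, v j = ∑ j, e j := by
    rw [← hp, Finset.mul_sum]
    exact Finset.sum_congr rfl fun i _ => huv i
  have husp : (∑ j, g j) * ∑ j, v j = ∑ j, g j := by
    rw [Finset.mul_sum]
    exact Finset.sum_congr rfl fun i _ => husv i
  have huus : (∑ j, e j) * ∑ j, g j = ∑ j, v j := by
    rw [Finset.sum_mul]
    refine Finset.sum_congr rfl fun i _ => ?_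
    rw [← hev i, mul_assoc, hvus, ← hck]
  have husu : (∑ j, g j) * ∑ j, e j = ∑ j, v j := by
    rw [Finset.sum_mul, ← hp]
    refine Finset.sum_congr rfl fun i _ => ?_
    rw [← hgv i, mul_assoc, hvu, hge]
  refine ⟨⟨(∑ j, e j) + 1 - ∑ j, v j, (∑ j, g j) + 1 - ∑ j, v j, ?_, ?_⟩, fun i => ⟨?_, ?_, ?_⟩⟩
  · simp only [sub_mul, mul_sub, add_mul, mul_add, one_mul, mul_one, huus, hup, hpus, hpp]
    abel
  · simp only [sub_mul, mul_sub, add_mul, mul_add, one_mul, mul_one, husu, husp, hpu, hpp]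
    abel
  · simp [mul_sub, mul_add, hvu, hvp]
  · simp [sub_mul, add_mul, huv, hpv]
  · simp [mul_sub, mul_add, hvus, hvp]

/-- Reduction of an integer modulo `n`, as an element of `Fin n`. -/
def zfin (n : ℕ) (hn : 0 < n) (a : ℤ) : Fin n :=
  ⟨(a % n).toNat, by
    have h1 := Int.emod_lt_of_pos a (by exact_mod_cast hn : (0 : ℤ) < n)
    have h0 := Int.emod_nonneg a (by exact_mod_cast hn.ne' : (n : ℤ) ≠ 0)
    omega⟩

theorem zfin_val (n : ℕ) (hn : 0 < n) (a : ℤ) : (((zfin n hn a : Fin n) : ℕ) : ℤ) = a % n :=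
  Int.toNat_of_nonneg (Int.emod_nonneg a (by exact_mod_cast hn.ne'))

theorem zfin_eq_iff (n : ℕ) (hn : 0 < n) (a b : ℤ) :
    zfin n hn a = zfin n hn b ↔ a % n = b % n := by
  rw [← zfin_val n hn, ← zfin_val n hn, Fin.ext_iff]
  norm_cast

theorem zfin_coe (n : ℕ) (hn : 0 < n) (i : Fin n) : zfin n hn ((i : ℕ) : ℤ) = i := by
  apply Fin.ext
  have := zfin_val n hn ((i : ℕ) : ℤ)
  rw [← Int.natCast_mod, Nat.mod_eq_of_lt i.2] at this
  exact_mod_cast this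

/-- The successor (range) map. -/
def nxt (n : ℕ) (hn : 0 < n) (i : Fin n) : Fin n := ⟨(i.1 + 1) % n, Nat.mod_lt _ hn⟩

theorem nxt_zfin (n : ℕ) (hn : 0 < n) (a : ℤ) : nxt n hn (zfin n hn a) = zfin n hn (a + 1) := by
  apply Fin.ext
  have h1 := zfin_val n hn (a + 1)
  have h2 := zfin_val n hn a
  have : ((nxt n hn (zfin n hn a) : Fin n) : ℕ) = ((zfin n hn a : Fin n) + 1 : ℕ) % n := rfl
  zify
  rw [h1, this]
  push_cast
  rw [h2, Int.emod_add_emod]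

theorem nxt_coe (n : ℕ) (hn : 0 < n) (i : Fin n) :
    nxt n hn i = zfin n hn ((i : ℕ) + 1) := by
  rw [← nxt_zfin, zfin_coe]

theorem nxt_injective (n : ℕ) (hn : 0 < n) : Function.Injective (nxt n hn) := by
  intro i j h
  rw [nxt_coe, nxt_coe, zfin_eq_iff] at h
  have h' := (Int.ModEq.add_right_cancel' 1 h : ((i : ℕ) : ℤ) ≡ ((j : ℕ) : ℤ) [ZMOD n])
  rw [← zfin_coe n hn i, ← zfin_coe n hn j, zfin_eq_iff]
  exact h'

/-- The matrix units with Laurent monomial entries. -/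
def mun (R : Type) [CommRing R] (n : ℕ) (hn : 0 < n) (a b : ℤ) :
    Matrix (Fin n) (Fin n) (LaurentPolynomial R) :=
  Matrix.single (zfin n hn a) (zfin n hn b) (LaurentPolynomial.T (b / n - a / n))

theorem mun_mul (R : Type) [CommRing R] (n : ℕ) (hn : 0 < n) (a b c : ℤ) :
    mun R n hn a b * mun R n hn b c = mun R n hn a c := by
  rw [mun, mun, mun, Matrix.single_mul_single_same, ← LaurentPolynomial.T_add]
  congr 2
  ring

theorem mun_mul_ne (R : Type) [CommRing R] (n : ℕ) (hn : 0 < n) (a b c d : ℤ)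
    (h : zfin n hn b ≠ zfin n hn c) :
    mun R n hn a b * mun R n hn c d = 0 := by
  rw [mun, mun, Matrix.single_mul_single_of_ne _ _ _ _ h]

theorem mun_self (R : Type) [CommRing R] (n : ℕ) (hn : 0 < n) (a b : ℤ)
    (h : zfin n hn a = zfin n hn b) :
    mun R n hn a a = mun R n hn b b := by
  simp [mun, h]

theorem mun_shift (R : Type) [CommRing R] (n : ℕ) (hn : 0 < n) (a b c d : ℤ)
    (h : zfin n hn a = zfin n hn c) (hd : b - a = d - c) :
    mun R n hn a b = mun R n hn c d := by
  have hn' : (n : ℤ) ≠ 0 := by exact_mod_cast hn.ne'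
  have h' := (zfin_eq_iff n hn a c).mp h
  obtain ⟨k, hk⟩ : (n : ℤ) ∣ c - a := Int.ModEq.dvd h'
  have hc : c = a + n * k := by linarith
  have hdd : d = b + n * k := by linarith
  have hb : zfin n hn b = zfin n hn d := by
    rw [zfin_eq_iff, hdd, Int.add_mul_emod_self_left]
  rw [mun, mun, h, hb, hc, hdd, Int.add_mul_ediv_left _ _ hn', Int.add_mul_ediv_left _ _ hn']
  congr 2
  ring

/-- Images of the generators in the matrix ring. -/
def genImg (R : Type) [CommRing R] (n : ℕ) (hn : 0 < n) :
    LGen (cycleGraph n hn) → Matrix (Fin n) (Fin n) (LaurentPolynomial R)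
  | .vert i => mun R n hn (Fin.val i : ℕ) (Fin.val i : ℕ)
  | .edge i => mun R n hn (Fin.val i : ℕ) ((Fin.val i : ℕ) + 1)
  | .ghost i => mun R n hn ((Fin.val i : ℕ) + 1) (Fin.val i : ℕ)

theorem genImg_rng (R : Type) [CommRing R] (n : ℕ) (hn : 0 < n) (i : Fin n) :
    genImg R n hn (LGen.vert ((cycleGraph n hn).rng i)) =
      mun R n hn ((i : ℕ) + 1) ((i : ℕ) + 1) := by
  exact mun_self R n hn _ _ ((zfin_coe n hn (nxt n hn i)).trans (nxt_coe n hn i))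

theorem genImg_rel (R : Type) [CommRing R] (n : ℕ) (hn : 0 < n)
    ⦃x y : FreeAlgebra R (LGen (cycleGraph n hn))⦄
    (h : LeavittRel R (cycleGraph n hn) x y) :
    FreeAlgebra.lift R (genImg R n hn) x = FreeAlgebra.lift R (genImg R n hn) y := by
  induction h with
  | vert_mul_self v => simp only [map_mul, FreeAlgebra.lift_ι_apply]; exact mun_mul _ _ _ _ _ _
  | vert_mul_vert v w hvw =>
    simp only [map_mul, map_zero, FreeAlgebra.lift_ι_apply]
    exact mun_mul_ne _ _ _ _ _ _ _ (fun h => hvw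
      ((zfin_coe n hn v).symm.trans (h.trans (zfin_coe n hn w))))
  | src_mul_edge e => simp only [map_mul, FreeAlgebra.lift_ι_apply]; exact mun_mul _ _ _ _ _ _
  | edge_mul_rng e =>
    simp only [map_mul, FreeAlgebra.lift_ι_apply]
    have hr := genImg_rng R n hn e
    exact (congrArg _ hr).trans (mun_mul _ _ _ _ _ _)

  | rng_mul_ghost e =>
    simp only [map_mul, FreeAlgebra.lift_ι_apply]
    have hr := genImg_rng R n hn e
    exact (congrArg (· * genImg R n hn (LGen.ghost e)) hr).trans (mun_mul _ _ _ _ _ _)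

  | ghost_mul_src e => simp only [map_mul, FreeAlgebra.lift_ι_apply]; exact mun_mul _ _ _ _ _ _
  | ghost_mul_self e =>
    simp only [map_mul, FreeAlgebra.lift_ι_apply]
    have hr := genImg_rng R n hn e
    exact (mun_mul _ _ _ _ _ _).trans hr.symm

  | ghost_mul_edge e f hef =>
    simp only [map_mul, map_zero, FreeAlgebra.lift_ι_apply]
    exact mun_mul_ne _ _ _ _ _ _ _ (fun h => hef
      ((zfin_coe n hn e).symm.trans (h.trans (zfin_coe n hn f))))
  | ck v s hs hne =>
    obtain ⟨f, hf⟩ := hne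
    have hs' : s = {f} := by
      ext e
      rw [hs, Finset.mem_singleton, ← (hs f).mp hf]
      rfl
    have hfv : f = v := (hs f).mp hf
    subst hfv
    rw [hs', Finset.sum_singleton]
    simp only [map_mul, FreeAlgebra.lift_ι_apply]
    exact (mun_mul _ _ _ _ _ _).symm

/-- The homomorphism from the ambient algebra to matrices. -/
def toMat (R : Type) [CommRing R] (n : ℕ) (hn : 0 < n) :
    Ambient R (cycleGraph n hn) →ₐ[R] Matrix (Fin n) (Fin n) (LaurentPolynomial R) :=
  RingQuot.liftAlgHom R ⟨FreeAlgebra.lift R (genImg R n hn), genImg_rel R n hn⟩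

theorem toMat_ugen (R : Type) [CommRing R] (n : ℕ) (hn : 0 < n) (x : LGen (cycleGraph n hn)) :
    toMat R n hn (ugen R _ x) = genImg R n hn x := by
  rw [toMat, ugen, RingQuot.liftAlgHom_mkAlgHom_apply, FreeAlgebra.lift_ι_apply]

theorem ugen_rel (R : Type) [CommRing R] (G : LPAGraph) {x y : FreeAlgebra R (LGen G)}
    (h : LeavittRel R G x y) :
    RingQuot.mkAlgHom R (LeavittRel R G) x = RingQuot.mkAlgHom R (LeavittRel R G) y :=
  RingQuot.mkAlgHom_rel R h

theorem exists_unit (R : Type) [CommRing R] (n : ℕ) (hn : 0 < n) :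
    ∃ U : (Ambient R (cycleGraph n hn))ˣ, ∀ i : Fin n,
      ugen R (cycleGraph n hn) (.vert i) * (U : Ambient R (cycleGraph n hn))
        = ugen R (cycleGraph n hn) (.edge i) ∧
      (U : Ambient R (cycleGraph n hn)) * ugen R (cycleGraph n hn) (.vert (nxt n hn i))
        = ugen R (cycleGraph n hn) (.edge i) ∧
      ugen R (cycleGraph n hn) (.vert (nxt n hn i)) *
        ((U⁻¹ : (Ambient R (cycleGraph n hn))ˣ) : Ambient R (cycleGraph n hn))
        = ugen R (cycleGraph n hn) (.ghost i) := by
  apply exists_cycle_unit (ι := Fin n) (nxt n hn) (nxt_injective n hn)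
    (fun i => ugen R (cycleGraph n hn) (.vert i)) (fun i => ugen R (cycleGraph n hn) (.edge i))
    (fun i => ugen R (cycleGraph n hn) (.ghost i))
  · intro i
    have := ugen_rel R _ (LeavittRel.vert_mul_self (R := R) (G := cycleGraph n hn) i)
    rw [map_mul] at this
    exact this
  · intro i j hij
    have := ugen_rel R _ (LeavittRel.vert_mul_vert (R := R) (G := cycleGraph n hn) i j hij)
    rw [map_mul, map_zero] at this
    exact this
  · intro i
    have := ugen_rel R _ (LeavittRel.src_mul_edge (R := R) (G := cycleGraph n hn) i)
    rw [map_mul] at this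
    exact this
  · intro i
    have := ugen_rel R _ (LeavittRel.edge_mul_rng (R := R) (G := cycleGraph n hn) i)
    rw [map_mul] at this
    exact this
  · intro i
    have := ugen_rel R _ (LeavittRel.rng_mul_ghost (R := R) (G := cycleGraph n hn) i)
    rw [map_mul] at this
    exact this
  · intro i
    have := ugen_rel R _ (LeavittRel.ghost_mul_src (R := R) (G := cycleGraph n hn) i)
    rw [map_mul] at this
    exact this
  · intro i
    have := ugen_rel R _ (LeavittRel.ghost_mul_self (R := R) (G := cycleGraph n hn) i)
    rw [map_mul] at this
    exact this
  · intro i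
    have key : ∀ e : (cycleGraph n hn).E,
        ugen R (cycleGraph n hn) (.vert ((cycleGraph n hn).src e)) =
          ugen R (cycleGraph n hn) (.edge e) * ugen R (cycleGraph n hn) (.ghost e) := by
      intro e
      have := ugen_rel R _ (LeavittRel.ck (R := R) (G := cycleGraph n hn)
        ((cycleGraph n hn).src e) {e}
        (fun e => Finset.mem_singleton) (Finset.singleton_nonempty _))
      rw [Finset.sum_singleton, map_mul] at this
      exact this
    exact key i

/-- The key facts packaged: a two-parameter family of elements spanning the Leavitt path
algebra and mapping to the matrix units. -/
theorem exists_family (R : Type) [CommRing R] (n : ℕ) (hn : 0 < n) :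
    ∃ w : ℤ → ℤ → Ambient R (cycleGraph n hn),
      (∀ a b, w a b ∈ LeavittSubalgebra R (cycleGraph n hn)) ∧
      (∀ a b, toMat R n hn (w a b) = mun R n hn a b) ∧
      (∀ a b c d, zfin n hn a = zfin n hn c → b - a = d - c → w a b = w c d) ∧
      (∀ x ∈ LeavittSubalgebra R (cycleGraph n hn),
        x ∈ Submodule.span R (Set.range fun p : ℤ × ℤ => w p.1 p.2)) := by
  obtain ⟨U, hU⟩ := exists_unit R n hn
  let V : ℤ → Ambient R (cycleGraph n hn) := fun a => ugen R _ (.vert (zfin n hn a))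
  have hVE : ∀ a, V a * (U : Ambient R (cycleGraph n hn)) =
      ugen R (cycleGraph n hn) (.edge (zfin n hn a)) := fun a => (hU _).1
  have hEV : ∀ a, (U : Ambient R (cycleGraph n hn)) * V (a + 1) =
      ugen R (cycleGraph n hn) (.edge (zfin n hn a)) := fun a => by
    have := (hU (zfin n hn a)).2.1
    rwa [nxt_zfin] at this
  have hVG : ∀ a, V (a + 1) * ((U⁻¹ : (Ambient R (cycleGraph n hn))ˣ) : Ambient R _) =
      ugen R (cycleGraph n hn) (.ghost (zfin n hn a)) := fun a => by
    have := (hU (zfin n hn a)).2.2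
    rwa [nxt_zfin] at this
  have hVV : ∀ a b, zfin n hn a = zfin n hn b → V a * V b = V a := by
    intro a b h
    have := ugen_rel R _ (LeavittRel.vert_mul_self (G := cycleGraph n hn) (zfin n hn a))
    rw [map_mul] at this
    simp only [V, ← h]
    exact this
  have hVne : ∀ a b, zfin n hn a ≠ zfin n hn b → V a * V b = 0 := by
    intro a b h
    have := ugen_rel R _ (LeavittRel.vert_mul_vert (G := cycleGraph n hn) _ _ h)
    rw [map_mul, map_zero] at this
    exact this
  have hcomm1 : ∀ a, V a * (U : Ambient R (cycleGraph n hn)) = U * V (a + 1) := fun a => by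
    rw [hVE, hEV]
  have hcomm2 : ∀ a, V (a + 1) * ((U⁻¹ : (Ambient R (cycleGraph n hn))ˣ) : Ambient R _) =
      ((U⁻¹ : (Ambient R (cycleGraph n hn))ˣ) : Ambient R _) * V a := fun a => by
    rw [Units.mul_inv_eq_iff_eq_mul, mul_assoc, hcomm1, Units.inv_mul_cancel_left]
  have hcomm : ∀ (k a : ℤ), V a * ((U ^ k : (Ambient R (cycleGraph n hn))ˣ) : Ambient R _) =
      ((U ^ k : (Ambient R (cycleGraph n hn))ˣ) : Ambient R _) * V (a + k) := by
    intro k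
    induction k using Int.induction_on with
    | zero => simp
    | succ k ih =>
      intro a
      rw [zpow_add_one, Units.val_mul, ← mul_assoc, ih, mul_assoc, hcomm1, mul_assoc, add_assoc]
    | pred k ih =>
      intro a
      have h2 := hcomm2 (a + -(k : ℤ) - 1)
      rw [sub_add_cancel] at h2
      rw [zpow_sub_one, Units.val_mul, ← mul_assoc, ih, mul_assoc, h2, mul_assoc, add_sub_assoc]
  let w : ℤ → ℤ → Ambient R (cycleGraph n hn) := fun a b =>
    V a * ((U ^ (b - a) : (Ambient R (cycleGraph n hn))ˣ) : Ambient R _)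
  have hw0 : ∀ a, w a a = V a := fun a => by simp [w]
  have hwV : ∀ a b, w a b * V b = w a b := fun a b => by
    simp only [w]
    have := hcomm (b - a) a
    rw [add_sub_cancel] at this
    rw [this, mul_assoc, hVV _ _ rfl]
  have hwU : ∀ a b, w a b * (U : Ambient R (cycleGraph n hn)) = w a (b + 1) := fun a b => by
    simp only [w]
    rw [mul_assoc, ← Units.val_mul, ← zpow_add_one]
    congr 3
    ring
  have hwsucc : ∀ a b, w a (b + 1) =
      w a b * ugen R (cycleGraph n hn) (.edge (zfin n hn b)) := fun a b => by
    rw [← hVE, ← mul_assoc, hwV, hwU]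
  have hwpred : ∀ a b, w a b =
      w a (b + 1) * ugen R (cycleGraph n hn) (.ghost (zfin n hn b)) := fun a b => by
    rw [← hVG, ← mul_assoc, hwV, ← hwU, Units.mul_inv_cancel_right]
  have hshift : ∀ a b c d, zfin n hn a = zfin n hn c → b - a = d - c → w a b = w c d := by
    intro a b c d h h'
    simp only [w, V, h, h']
  have hedge : ∀ i : Fin n, ugen R (cycleGraph n hn) (.edge i) = w (i : ℕ) ((i : ℕ) + 1) := by
    intro i
    have := hVE (i : ℕ)
    rw [zfin_coe] at this
    rw [← this, ← hw0, hwU]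
  have hghost : ∀ i : Fin n, ugen R (cycleGraph n hn) (.ghost i) = w ((i : ℕ) + 1) (i : ℕ) := by
    intro i
    have := hVG (i : ℕ)
    rw [zfin_coe] at this
    rw [← this]
    simp [w]
  have hvert : ∀ i : Fin n, ugen R (cycleGraph n hn) (.vert i) = w (i : ℕ) (i : ℕ) := by
    intro i
    rw [hw0]
    simp only [V, zfin_coe]
  have hmul : ∀ a b c d, w a b * w c d = 0 ∨ w a b * w c d = w a (b + d - c) := by
    intro a b c d
    have h1 : w a b * w c d = w a b * (V b * V c) *
        ((U ^ (d - c) : (Ambient R (cycleGraph n hn))ˣ) : Ambient R _) := by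
      rw [← mul_assoc (w a b) (V b), hwV]
      exact (mul_assoc _ _ _).symm
    by_cases h : zfin n hn b = zfin n hn c
    · right
      rw [h1, hVV _ _ h, hwV]
      simp only [w]
      rw [mul_assoc, ← Units.val_mul, ← zpow_add]
      congr 3
      ring
    · left
      rw [h1, hVne _ _ h, mul_zero, zero_mul]
  have hind : ∀ (P : ℤ → Prop) (a : ℤ), P a → (∀ b, P b → P (b + 1)) →
      (∀ b, P (b + 1) → P b) → ∀ b, P b := by
    intro P a h0 hs hp b
    have : ∀ k : ℤ, P (a + k) := by
      intro k
      induction k using Int.induction_on with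
      | zero => simpa using h0
      | succ k ih => rw [← add_assoc]; exact hs _ ih
      | pred k ih =>
        apply hp
        convert ih using 1
        ring
    simpa using this (b - a)
  refine ⟨w, ?_, ?_, hshift, ?_⟩
  · intro a
    refine hind _ a ?_ ?_ ?_
    · rw [hw0]
      exact ugen_mem _ _ _
    · intro b hb
      rw [hwsucc]
      exact mul_mem hb (ugen_mem _ _ _)
    · intro b hb
      rw [hwpred]
      exact mul_mem hb (ugen_mem _ _ _)
  · intro a
    refine hind _ a ?_ ?_ ?_
    · rw [hw0, toMat_ugen]
      exact mun_self _ _ _ _ _ (zfin_coe _ _ _)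
    · intro b hb
      rw [hwsucc, map_mul, hb, toMat_ugen]
      have : genImg R n hn (.edge (zfin n hn b)) = mun R n hn b (b + 1) :=
        mun_shift _ _ _ _ _ _ _ (zfin_coe _ _ _) (by ring)
      rw [this, mun_mul]
    · intro b hb
      rw [hwpred, map_mul, hb, toMat_ugen]
      have : genImg R n hn (.ghost (zfin n hn b)) = mun R n hn (b + 1) b := by
        refine mun_shift _ _ _ _ _ _ _ ?_ (by ring)
        rw [← nxt_zfin n hn b]
        exact (nxt_coe n hn (zfin n hn b)).symm
      rw [this, mun_mul]
  · intro x hx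
    have hwS : ∀ a b, w a b ∈ Submodule.span R (Set.range fun p : ℤ × ℤ => w p.1 p.2) :=
      fun a b => Submodule.subset_span ⟨(a, b), rfl⟩
    refine NonUnitalAlgebra.adjoin_induction
      (p := fun x _ => x ∈ Submodule.span R (Set.range fun p : ℤ × ℤ => w p.1 p.2))
      ?_ ?_ ?_ ?_ ?_ hx
    · rintro _ ⟨g, rfl⟩
      cases g with
      | vert i => exact (hvert i).symm ▸ hwS _ _
      | edge i => exact (hedge i).symm ▸ hwS _ _
      | ghost i => exact (hghost i).symm ▸ hwS _ _
    · intro x y _ _ hx hy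
      exact add_mem hx hy
    · exact zero_mem _
    · intro x y _ _ hx hy
      have hxy := Submodule.mul_mem_mul hx hy
      rw [Submodule.span_mul_span] at hxy
      refine Submodule.span_le.mpr ?_ hxy
      rintro _ ⟨_, ⟨⟨a, b⟩, rfl⟩, _, ⟨⟨c, d⟩, rfl⟩, rfl⟩
      rcases hmul a b c d with h | h
      · simp only [h]
        exact zero_mem _
      · simp only [h]
        exact hwS _ _
    · intro r x _ hx
      exact Submodule.smul_mem _ r hx

end LPAGraph

open LPAGraph in
/-- **Lemma.**  If `E` is the graph consisting of a single simple closed path of length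
`n ≥ 1` and `R` is a commutative ring with unit, then `L_R(E) ≅ Mₙ(R[x, x⁻¹])`, the
`n × n` matrices over the Laurent polynomial ring over `R` (an isomorphism of
(nonunital) `R`-algebras, i.e. a bijective `R`-algebra homomorphism). -/
theorem stmt16 (R : Type) [CommRing R] (n : ℕ) (hn : 0 < n) :
    ∃ φ : LeavittPathAlgebra R (cycleGraph n hn) →ₙₐ[R]
        Matrix (Fin n) (Fin n) (LaurentPolynomial R),
      Function.Bijective φ := by
  obtain ⟨w, hwL, hwM, hwshift, hspan⟩ := exists_family R n hn
  have hn' : (n : ℤ) ≠ 0 := by exact_mod_cast hn.ne'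
  let c : Fin n → Fin n → LaurentPolynomial R →ₗ[R] Ambient R (cycleGraph n hn) := fun i j =>
    (Finsupp.linearCombination R fun k : ℤ => w (i : ℕ) ((j : ℕ) + n * k)) ∘ₗ
      (AddMonoidAlgebra.coeffLinearEquiv R).toLinearMap
  let ψ : Matrix (Fin n) (Fin n) (LaurentPolynomial R) →ₗ[R] Ambient R (cycleGraph n hn) :=
    ∑ i, ∑ j, c i j ∘ₗ Matrix.entryLinearMap R (LaurentPolynomial R) i j
  have hψ : ∀ i j k, ψ (Matrix.single i j (LaurentPolynomial.T k)) =
      w (i : ℕ) ((j : ℕ) + n * k) := by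
    intro i j k
    simp only [ψ, LinearMap.sum_apply, LinearMap.comp_apply, Matrix.entryLinearMap_apply]
    rw [Finset.sum_eq_single i, Finset.sum_eq_single j]
    · rw [Matrix.single_apply_same]
      change Finsupp.linearCombination R _ (Finsupp.single k (1 : R)) = _
      rw [Finsupp.linearCombination_single, one_smul]
    · intro j' _ hj
      exact (congrArg _ (Matrix.single_apply_of_col_ne i i hj.symm _)).trans (map_zero _)
    · simp
    · intro i' _ hi
      refine Finset.sum_eq_zero fun j' _ => ?_
      exact (congrArg _ (Matrix.single_apply_of_row_ne hi.symm j j' _)).trans (map_zero _)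
    · simp
  have hψw : ∀ a b, ψ (toMat R n hn (w a b)) = w a b := by
    intro a b
    rw [hwM, mun, hψ]
    apply hwshift
    · rw [zfin_coe]
    · rw [zfin_val, zfin_val]
      have h1 := Int.emod_add_mul_ediv a n
      have h2 := Int.emod_add_mul_ediv b n
      linear_combination h2 - h1
  have hψL : ∀ x ∈ LeavittSubalgebra R (cycleGraph n hn), ψ (toMat R n hn x) = x := by
    intro x hx
    have hS := hspan x hx
    clear hx
    induction hS using Submodule.span_induction with
    | mem x h =>
      obtain ⟨p, rfl⟩ := h
      exact hψw _ _
    | zero => simp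
    | add x y _ _ h1 h2 => rw [map_add, map_add, h1, h2]
    | smul r x _ h => rw [map_smul, map_smul, h]
  refine ⟨((toMat R n hn : Ambient R (cycleGraph n hn) →ₙₐ[R] _)).comp
    (NonUnitalSubalgebraClass.subtype (LeavittSubalgebra R (cycleGraph n hn))), ?_, ?_⟩
  · intro x y hxy
    apply Subtype.ext
    rw [← hψL x x.2, ← hψL y y.2]
    exact congrArg ψ hxy
  · intro M
    suffices h : M ∈ (LeavittSubalgebra R (cycleGraph n hn)).toSubmodule.map
        (toMat R n hn).toLinearMap by
      obtain ⟨x, hx, hxM⟩ := h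
      exact ⟨⟨x, hx⟩, hxM⟩
    rw [Matrix.matrix_eq_sum_single M]
    refine sum_mem fun i _ => sum_mem fun j _ => ?_
    induction M i j using LaurentPolynomial.induction_on' with
    | add p q hp hq =>
      rw [Matrix.single_add]
      exact add_mem hp hq
    | C_mul_T k r =>
      rw [← LaurentPolynomial.smul_eq_C_mul, ← Matrix.smul_single]
      refine Submodule.smul_mem _ _ ⟨w (i : ℕ) ((j : ℕ) + n * k), hwL _ _, ?_⟩
      have hi : ((i : ℕ) : ℤ) / n = 0 := Int.ediv_eq_zero_of_lt (by positivity) (by exact_mod_cast i.2)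
      have hj : ((j : ℕ) : ℤ) / n = 0 := Int.ediv_eq_zero_of_lt (by positivity) (by exact_mod_cast j.2)
      have hz : zfin n hn ((j : ℕ) + n * k) = j := by
        conv_rhs => rw [← zfin_coe n hn j]
        rw [zfin_eq_iff, Int.add_mul_emod_self_left]
      change toMat R n hn _ = _
      rw [hwM, mun, zfin_coe, hz, Int.add_mul_ediv_left _ _ hn', hi, hj]
      simp
end
end
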